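/- arXiv:2210.02417 — 3 statements merged into one kernel-verified Lean document; each statement's English description precedes it below -/
import Mathlib

section
/- Let v be a viscosity supersolution of the quasi-variational inequality min{ v(t,x) − Mv(t,x), −∂_t v(t,x) − Lv(t,x) − f(t,x, v(t,x), σ^⊤(t,x)∇_x v(t,x)) } = 0 on [0,T) × ℝ^n, v(T,·) = ψ, satisfying |v(t,x)| ≤ C(1+|x|^{2ϱ}) for all (t,x) and some C, ϱ > 0. Then there exists γ₀ > 0 such that for every γ > γ₀ and every θ > 0, the function (t,x) ↦ v(t,x) + θ e^{−γt}(1 + ((|x| − K_Γ)^+)^{2ϱ+2}) is also a viscosity supersolution of the same quasi-variational inequality. -/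
open Set Filter Matrix Topology

noncomputable section

/-- The state space `ℝ^n` with the Euclidean norm. -/
abbrev En (n : ℕ) : Type := EuclideanSpace ℝ (Fin n)

/-- The space `ℝ^d` (values of `σᵀ∇v`). -/
abbrev Ed (d : ℕ) : Type := EuclideanSpace ℝ (Fin d)

/-- Frobenius norm of a matrix. -/
noncomputable def frob {n d : ℕ} (M : Matrix (Fin n) (Fin d) ℝ) : ℝ :=
  Real.sqrt (∑ i, ∑ j, (M i j) ^ 2)

/-- The intervention operator `Mv(t,x) = sup_b { v(t,Γ(t,x,b)) - ℓ(t,x,b) }`. -/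
noncomputable def Mop {n : ℕ} {U : Type} [Nonempty U]
    (Γ : ℝ → En n → U → En n) (ℓ : ℝ → En n → U → ℝ)
    (v : ℝ → En n → ℝ) (t : ℝ) (x : En n) : ℝ :=
  ⨆ b : U, (v t (Γ t x b) - ℓ t x b)

/-- The (parabolic) domain `[0,T] × ℝ^n`. -/
def Strip (n : ℕ) (T : ℝ) : Set (ℝ × En n) := Icc 0 T ×ˢ (univ : Set (En n))

/-- First-order partial derivative `∂g/∂x_i`. -/
noncomputable def pd {n : ℕ} (g : En n → ℝ) (x : En n) (i : Fin n) : ℝ :=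
  fderiv ℝ g x (EuclideanSpace.single i 1)

/-- Second-order partial derivative `∂²g/∂x_i∂x_j`. -/
noncomputable def pd2 {n : ℕ} (g : En n → ℝ) (x : En n) (i j : Fin n) : ℝ :=
  fderiv ℝ (fun y => fderiv ℝ g y (EuclideanSpace.single j 1)) x (EuclideanSpace.single i 1)

/-- The generator `Lφ = Σ_j a_j ∂φ/∂x_j + (1/2) Σ_{i,j} (σσᵀ)_{ij} ∂²φ/∂x_i∂x_j`. -/
noncomputable def genL {n d : ℕ} (a : ℝ → En n → En n)
    (σm : ℝ → En n → Matrix (Fin n) (Fin d) ℝ)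
    (φ : ℝ → En n → ℝ) (t : ℝ) (x : En n) : ℝ :=
  (∑ j, a t x j * pd (φ t) x j)
    + (1/2) * ∑ i, ∑ j, (σm t x * (σm t x)ᵀ) i j * pd2 (φ t) x i j

/-- `σ(t,x)ᵀ ∇_x φ(t,x) ∈ ℝ^d`. -/
noncomputable def sigGrad {n d : ℕ} (σm : ℝ → En n → Matrix (Fin n) (Fin d) ℝ)
    (φ : ℝ → En n → ℝ) (t : ℝ) (x : En n) : Ed d :=
  (WithLp.equiv 2 (Fin d → ℝ)).symm (fun k => ∑ i, σm t x i k * pd (φ t) x i)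

/-- Test functions: `C¹` in `t` and `C²` in `x` (jointly `C²`). -/
def IsTest {n : ℕ} (φ : ℝ → En n → ℝ) : Prop :=
  ContDiff ℝ 2 (fun p : ℝ × En n => φ p.1 p.2)

/-- Time derivative `∂φ/∂t`. -/
noncomputable def ptd {n : ℕ} (φ : ℝ → En n → ℝ) (t : ℝ) (x : En n) : ℝ :=
  deriv (fun s => φ s x) t

/-- Polynomial growth in `x`, uniformly for `t ∈ [0,T]` (the class `Π^g`). -/
def PolyGrowth {n : ℕ} (T : ℝ) (φ : ℝ → En n → ℝ) : Prop :=
  ∃ C > (0:ℝ), ∃ ρ > (0:ℝ), ∀ t ∈ Icc (0:ℝ) T, ∀ x : En n, |φ t x| ≤ C * (1 + ‖x‖ ^ ρ)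

/-- The class `Π^g_c`: jointly continuous functions of polynomial growth. -/
def PGc {n : ℕ} (T : ℝ) (φ : ℝ → En n → ℝ) : Prop :=
  PolyGrowth T φ ∧ ContinuousOn (fun p : ℝ × En n => φ p.1 p.2) (Strip n T)

/-- Locally bounded on `[0,T] × ℝ^n`. -/
def LocBdd {n : ℕ} (T : ℝ) (g : ℝ → En n → ℝ) : Prop :=
  ∀ p ∈ Strip n T, ∃ s ∈ 𝓝 p, ∃ C : ℝ, ∀ q ∈ s ∩ Strip n T, |g q.1 q.2| ≤ C

/-- Viscosity supersolution (local driver `f(t,x,y,z)`). -/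
def IsSuper {n d : ℕ} {U : Type} [Nonempty U] (T : ℝ)
    (Γ : ℝ → En n → U → En n) (ℓ : ℝ → En n → U → ℝ)
    (a : ℝ → En n → En n) (σm : ℝ → En n → Matrix (Fin n) (Fin d) ℝ)
    (f : ℝ → En n → ℝ → Ed d → ℝ) (ψ : En n → ℝ)
    (v : ℝ → En n → ℝ) : Prop :=
  LowerSemicontinuousOn (fun p : ℝ × En n => v p.1 p.2) (Strip n T) ∧
  (∀ x : En n, ψ x ≤ v T x) ∧
  ∀ t ∈ Ico (0:ℝ) T, ∀ x : En n, ∀ φ : ℝ → En n → ℝ, IsTest φ →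
    φ t x = v t x →
    IsLocalMaxOn (fun p : ℝ × En n => φ p.1 p.2 - v p.1 p.2) (Strip n T) (t, x) →
    0 ≤ min (v t x - Mop Γ ℓ v t x)
        (-(ptd φ t x) - genL a σm φ t x - f t x (v t x) (sigGrad σm φ t x))

/-- Viscosity subsolution (local driver `f(t,x,y,z)`). -/
def IsSub {n d : ℕ} {U : Type} [Nonempty U] (T : ℝ)
    (Γ : ℝ → En n → U → En n) (ℓ : ℝ → En n → U → ℝ)
    (a : ℝ → En n → En n) (σm : ℝ → En n → Matrix (Fin n) (Fin d) ℝ)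
    (f : ℝ → En n → ℝ → Ed d → ℝ) (ψ : En n → ℝ)
    (u : ℝ → En n → ℝ) : Prop :=
  UpperSemicontinuousOn (fun p : ℝ × En n => u p.1 p.2) (Strip n T) ∧
  (∀ x : En n, u T x ≤ ψ x) ∧
  ∀ t ∈ Ico (0:ℝ) T, ∀ x : En n, ∀ φ : ℝ → En n → ℝ, IsTest φ →
    φ t x = u t x →
    IsLocalMinOn (fun p : ℝ × En n => φ p.1 p.2 - u p.1 p.2) (Strip n T) (t, x) →
    min (u t x - Mop Γ ℓ u t x)
        (-(ptd φ t x) - genL a σm φ t x - f t x (u t x) (sigGrad σm φ t x)) ≤ 0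

/-- Viscosity supersolution (non-local driver `f(t,x,g,z)`, `g ∈ C(ℝ^n,ℝ)`). -/
def IsSuperNL {n d : ℕ} {U : Type} [Nonempty U] (T : ℝ)
    (Γ : ℝ → En n → U → En n) (ℓ : ℝ → En n → U → ℝ)
    (a : ℝ → En n → En n) (σm : ℝ → En n → Matrix (Fin n) (Fin d) ℝ)
    (f : ℝ → En n → (En n → ℝ) → Ed d → ℝ) (ψ : En n → ℝ)
    (v : ℝ → En n → ℝ) : Prop :=
  LowerSemicontinuousOn (fun p : ℝ × En n => v p.1 p.2) (Strip n T) ∧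
  (∀ x : En n, ψ x ≤ v T x) ∧
  ∀ t ∈ Ico (0:ℝ) T, ∀ x : En n, ∀ φ : ℝ → En n → ℝ, IsTest φ →
    φ t x = v t x →
    IsLocalMaxOn (fun p : ℝ × En n => φ p.1 p.2 - v p.1 p.2) (Strip n T) (t, x) →
    0 ≤ min (v t x - Mop Γ ℓ v t x)
        (-(ptd φ t x) - genL a σm φ t x - f t x (v t) (sigGrad σm φ t x))

/-- Viscosity subsolution (non-local driver `f(t,x,g,z)`). -/
def IsSubNL {n d : ℕ} {U : Type} [Nonempty U] (T : ℝ)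
    (Γ : ℝ → En n → U → En n) (ℓ : ℝ → En n → U → ℝ)
    (a : ℝ → En n → En n) (σm : ℝ → En n → Matrix (Fin n) (Fin d) ℝ)
    (f : ℝ → En n → (En n → ℝ) → Ed d → ℝ) (ψ : En n → ℝ)
    (u : ℝ → En n → ℝ) : Prop :=
  UpperSemicontinuousOn (fun p : ℝ × En n => u p.1 p.2) (Strip n T) ∧
  (∀ x : En n, u T x ≤ ψ x) ∧
  ∀ t ∈ Ico (0:ℝ) T, ∀ x : En n, ∀ φ : ℝ → En n → ℝ, IsTest φ →
    φ t x = u t x →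
    IsLocalMinOn (fun p : ℝ × En n => φ p.1 p.2 - u p.1 p.2) (Strip n T) (t, x) →
    min (u t x - Mop Γ ℓ u t x)
        (-(ptd φ t x) - genL a σm φ t x - f t x (u t) (sigGrad σm φ t x)) ≤ 0

/-- The truncated power `s ↦ (s⁺)^p`. -/
def posPow (p s : ℝ) : ℝ := (max s 0) ^ p

theorem posPow_nonneg (p s : ℝ) : 0 ≤ posPow p s :=
  Real.rpow_nonneg (le_max_right _ _) _

theorem posPow_of_nonpos {p s : ℝ} (hp : 0 < p) (hs : s ≤ 0) : posPow p s = 0 := by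
  rw [posPow, max_eq_right hs, Real.zero_rpow hp.ne']

theorem continuous_posPow {p : ℝ} (hp : 0 < p) : Continuous (posPow p) :=
  (continuous_id.max continuous_const).rpow_const fun _ => Or.inr hp.le

theorem posPow_succ {p s : ℝ} (hp : 0 < p) : posPow (p + 1) s = max s 0 * posPow p s := by
  rw [posPow, posPow, Real.rpow_add_one' (le_max_right _ _) (by linarith), mul_comm]

theorem hasDerivAt_posPow {p : ℝ} (hp : 1 < p) (s : ℝ) :
    HasDerivAt (posPow p) (p * posPow (p - 1) s) s := by
  rcases lt_trichotomy s 0 with hs | rfl | hs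
  · rw [posPow_of_nonpos (by linarith) hs.le, mul_zero]
    refine (hasDerivAt_const s (0 : ℝ)).congr_of_eventuallyEq ?_
    filter_upwards [eventually_lt_nhds hs] with r hr
    exact posPow_of_nonpos (by linarith) hr.le
  · rw [posPow_of_nonpos (by linarith) le_rfl, mul_zero]
    have h := hasDerivAt_abs_rpow (0 : ℝ) hp
    rw [mul_zero, hasDerivAt_iff_isLittleO] at h
    rw [hasDerivAt_iff_isLittleO]
    refine Asymptotics.IsBigO.trans_isLittleO (Asymptotics.IsBigO.of_bound 1 ?_) h
    refine Eventually.of_forall fun r => ?_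
    rw [posPow_of_nonpos (by linarith : 0 < p) le_rfl, abs_zero,
      Real.zero_rpow (by linarith : p ≠ 0)]
    simp only [sub_zero, smul_zero, Real.norm_eq_abs, one_mul]
    rw [abs_of_nonneg (posPow_nonneg _ _), abs_of_nonneg (Real.rpow_nonneg (abs_nonneg _) _)]
    exact Real.rpow_le_rpow (le_max_right _ _) (max_le (le_abs_self _) (abs_nonneg _)) (by linarith)
  · have h := Real.hasDerivAt_rpow_const (x := s) (p := p) (Or.inl hs.ne')
    have e : posPow (p - 1) s = s ^ (p - 1) := by rw [posPow, max_eq_left hs.le]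
    rw [e]
    refine h.congr_of_eventuallyEq ?_
    filter_upwards [eventually_gt_nhds hs] with r hr
    rw [posPow, max_eq_left hr.le]

theorem deriv_posPow {p : ℝ} (hp : 1 < p) : deriv (posPow p) = fun s => p * posPow (p - 1) s :=
  funext fun s => (hasDerivAt_posPow hp s).deriv

theorem contDiff_one_posPow {p : ℝ} (hp : 1 < p) : ContDiff ℝ 1 (posPow p) := by
  rw [contDiff_one_iff_deriv, deriv_posPow hp]
  exact ⟨fun s => (hasDerivAt_posPow hp s).differentiableAt,
    continuous_const.mul (continuous_posPow (by linarith))⟩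

theorem contDiff_two_posPow {p : ℝ} (hp : 2 < p) : ContDiff ℝ 2 (posPow p) := by
  have h1 : 1 < p := by linarith
  rw [show (2 : WithTop ℕ∞) = 1 + 1 by norm_num, contDiff_succ_iff_deriv, deriv_posPow h1]
  exact ⟨fun s => (hasDerivAt_posPow h1 s).differentiableAt, by simp,
    contDiff_const.mul (contDiff_one_posPow (by linarith))⟩

/-- The radial growth function `x ↦ ((|x| - K)⁺)^p`. -/
def radial {n : ℕ} (p K : ℝ) (x : En n) : ℝ := posPow p (‖x‖ - K)

theorem radial_eventually_zero {n : ℕ} {p K : ℝ} (hp : 0 < p) (hK : 0 < K) :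
    (radial p K : En n → ℝ) =ᶠ[𝓝 0] fun _ => 0 := by
  filter_upwards [Metric.ball_mem_nhds (0 : En n) hK] with y hy
  rw [mem_ball_zero_iff] at hy
  exact posPow_of_nonpos hp (by linarith)

theorem contDiff_radial {n : ℕ} {p K : ℝ} (hp : 2 < p) (hK : 0 < K) :
    ContDiff ℝ 2 (radial p K : En n → ℝ) := by
  rw [contDiff_iff_contDiffAt]
  intro x
  by_cases hx : x = 0
  · subst hx
    exact contDiffAt_const.congr_of_eventuallyEq (radial_eventually_zero (by linarith) hK)
  · exact (contDiff_two_posPow hp).contDiffAt.comp x ((contDiffAt_norm ℝ hx).sub contDiffAt_const)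

theorem hasFDerivAt_norm_of_ne {n : ℕ} {x : En n} (hx : x ≠ 0) :
    HasFDerivAt (fun y : En n => ‖y‖) (‖x‖⁻¹ • innerSL ℝ x) x := by
  have hn : ‖x‖ ≠ 0 := norm_ne_zero_iff.2 hx
  have h1 := (hasStrictFDerivAt_norm_sq x).hasFDerivAt.sqrt (by positivity)
  have e : (fun y : En n => ‖y‖) = fun y => √(‖y‖ ^ 2) := by
    ext y; rw [Real.sqrt_sq (norm_nonneg _)]
  rw [e]
  refine h1.congr_fderiv ?_
  rw [Real.sqrt_sq (norm_nonneg _)]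
  ext y
  simp
  field_simp

theorem hasFDerivAt_radial {n : ℕ} {p K : ℝ} (hp : 1 < p) (hK : 0 < K) (x : En n) :
    HasFDerivAt (radial p K : En n → ℝ)
      ((p * radial (p - 1) K x * ‖x‖⁻¹) • innerSL ℝ x) x := by
  by_cases hx : x = 0
  · subst hx
    rw [map_zero, smul_zero]
    exact (hasFDerivAt_const 0 0).congr_of_eventuallyEq
      (radial_eventually_zero (by linarith) hK)
  · have h := (hasDerivAt_posPow hp (‖x‖ - K)).comp_hasFDerivAt x
      ((hasFDerivAt_norm_of_ne hx).sub_const K)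
    rw [smul_smul] at h
    exact h

theorem pd_radial {n : ℕ} {p K : ℝ} (hp : 1 < p) (hK : 0 < K) (x : En n) (i : Fin n) :
    pd (radial p K) x i = p * radial (p - 1) K x * (‖x‖⁻¹ * x i) := by
  rw [pd, (hasFDerivAt_radial hp hK x).fderiv]
  simp [EuclideanSpace.inner_single_right]
  ring

theorem abs_coord_le {n : ℕ} (x : En n) (i : Fin n) : |x i| ≤ ‖x‖ := by
  simpa using PiLp.norm_apply_le x i

theorem abs_unit_coord_le {n : ℕ} (x : En n) (i : Fin n) : |‖x‖⁻¹ * x i| ≤ 1 := by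
  rw [abs_mul, abs_inv, abs_norm]
  exact inv_mul_le_one_of_le₀ (abs_coord_le x i) (norm_nonneg _)

theorem radial_nonneg {n : ℕ} (p K : ℝ) (x : En n) : 0 ≤ radial p K x := posPow_nonneg _ _

theorem abs_pd_radial_le {n : ℕ} {p K : ℝ} (hp : 1 < p) (hK : 0 < K) (x : En n) (i : Fin n) :
    |pd (radial p K) x i| ≤ p * radial (p - 1) K x := by
  have h0 : 0 ≤ p * radial (p - 1) K x := mul_nonneg (by linarith) (radial_nonneg _ _ _)
  rw [pd_radial hp hK, abs_mul, abs_of_nonneg h0]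
  exact mul_le_of_le_one_right h0 (abs_unit_coord_le x i)

theorem radial_succ_le {n : ℕ} {p K : ℝ} (hp : 0 < p) (hK : 0 < K) (x : En n) :
    radial (p + 1) K x ≤ ‖x‖ * radial p K x := by
  rw [radial, posPow_succ hp]
  exact mul_le_mul_of_nonneg_right (max_le (by linarith) (norm_nonneg _)) (posPow_nonneg _ _)

theorem abs_pd2_radial_le {n : ℕ} {p K : ℝ} (hp : 2 < p) (hK : 0 < K) (x : En n)
    (i j : Fin n) :
    |pd2 (radial p K) x i j| ≤ p * (p + 1) * radial (p - 2) K x := by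
  have hp0 : 0 < p := by linarith
  have hr := radial_nonneg (p - 2) K x
  have e : (fun y : En n => fderiv ℝ (radial p K) y (EuclideanSpace.single j 1)) =
      fun y => p * (radial (p - 1) K y * (‖y‖⁻¹ * y j)) := by
    ext y
    rw [← mul_assoc]
    exact pd_radial (by linarith) hK y j
  rw [pd2, e]
  by_cases hx : x = 0
  · subst hx
    have h : (fun y : En n => p * (radial (p - 1) K y * (‖y‖⁻¹ * y j))) =ᶠ[𝓝 0] fun _ => 0 := by
      filter_upwards [radial_eventually_zero (n := n) (p := p - 1) (by linarith) hK] with y hy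
      rw [hy]; ring
    rw [h.fderiv_eq]
    simp only [fderiv_fun_const, Pi.zero_apply, _root_.zero_apply, abs_zero]
    positivity
  · have hn : 0 < ‖x‖ := norm_pos_iff.2 hx
    have h1 := hasFDerivAt_radial (p := p - 1) (by linarith) hK x
    have h2 := (hasDerivAt_inv hn.ne').comp_hasFDerivAt x (hasFDerivAt_norm_of_ne hx)
    have h3 : HasFDerivAt (fun y : En n => y j)
        (EuclideanSpace.proj j : En n →L[ℝ] ℝ) x :=
      (EuclideanSpace.proj j : En n →L[ℝ] ℝ).hasFDerivAt
    have h := (h1.mul (h2.mul h3)).const_mul p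
    have hs := radial_succ_le (p := p - 2) (by linarith) hK x
    rw [show p - 2 + 1 = p - 1 by ring] at hs
    have hfd : fderiv ℝ (fun y : En n => p * (radial (p - 1) K y * (‖y‖⁻¹ * y j))) x
          (EuclideanSpace.single i 1) =
        p * (radial (p - 1) K x * ‖x‖⁻¹ *
            ((if j = i then 1 else 0) - (‖x‖⁻¹ * x i) * (‖x‖⁻¹ * x j))
          + (p - 1) * radial (p - 2) K x * ((‖x‖⁻¹ * x i) * (‖x‖⁻¹ * x j))) := by
      refine (congrArg (fun A : En n →L[ℝ] ℝ => A (EuclideanSpace.single i 1)) h.fderiv).trans ?_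
      simp only [show p - 1 - 1 = p - 2 by ring]
      split_ifs with hij <;> simp [EuclideanSpace.inner_single_right, hij] <;> field_simp <;> ring
    rw [hfd]
    have hu : |(‖x‖⁻¹ * x i) * (‖x‖⁻¹ * x j)| ≤ 1 := by
      rw [abs_mul]
      exact mul_le_one₀ (abs_unit_coord_le x i) (abs_nonneg _) (abs_unit_coord_le x j)
    have hq : radial (p - 1) K x * ‖x‖⁻¹ ≤ radial (p - 2) K x := by
      rw [← div_eq_mul_inv, div_le_iff₀ hn]; linarith
    have hq0 : 0 ≤ radial (p - 1) K x * ‖x‖⁻¹ :=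
      mul_nonneg (radial_nonneg _ _ _) (by positivity)
    have hd : |(if j = i then (1 : ℝ) else 0) - (‖x‖⁻¹ * x i) * (‖x‖⁻¹ * x j)| ≤ 2 := by
      refine (abs_sub _ _).trans ?_
      have : |(if j = i then (1 : ℝ) else 0)| ≤ 1 := by split_ifs <;> simp
      linarith
    rw [abs_mul, abs_of_pos hp0, mul_assoc p (p + 1)]
    refine mul_le_mul_of_nonneg_left ((abs_add_le _ _).trans ?_) hp0.le
    have hc : 0 ≤ (p - 1) * radial (p - 2) K x := mul_nonneg (by linarith) hr
    rw [abs_mul, abs_of_nonneg hq0, abs_mul ((p - 1) * _), abs_of_nonneg hc]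
    have b1 := mul_le_mul hq hd (abs_nonneg _) hr
    have b2 := mul_le_of_le_one_right hc hu
    linarith

/-- The growth of the coefficients is absorbed by the radial function. -/
theorem sq_mul_radial_le {n : ℕ} {p K : ℝ} (hp : 2 < p) (hK : 0 < K) (x : En n) :
    (1 + ‖x‖) ^ 2 * radial (p - 2) K x ≤ 4 * (1 + K) ^ 2 * (1 + radial p K x) := by
  rcases le_or_gt (‖x‖ - K) 0 with hx | hx
  · rw [radial, posPow_of_nonpos (by linarith) hx, mul_zero]
    have := radial_nonneg p K x
    positivity
  · set r := ‖x‖ - K with hrdef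
    have hrp : 0 < r ^ (p - 2) := Real.rpow_pos_of_pos hx _
    have e1 : radial (p - 2) K x = r ^ (p - 2) := by rw [radial, posPow, max_eq_left hx.le]
    have e2 : radial p K x = r ^ 2 * r ^ (p - 2) := by
      rw [radial, posPow, max_eq_left hx.le, ← Real.rpow_natCast, ← Real.rpow_add hx]
      congr 1; push_cast; ring
    rw [e1, e2]
    have hR : (1 + ‖x‖) ^ 2 ≤ (1 + K) ^ 2 * (1 + r) ^ 2 := by
      rw [← mul_pow]
      refine pow_le_pow_left₀ (by positivity) ?_ 2
      nlinarith
    have key : (1 + r) ^ 2 * r ^ (p - 2) ≤ 4 * (1 + r ^ 2 * r ^ (p - 2)) := by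
      rcases le_or_gt r 1 with h | h
      · have : r ^ (p - 2) ≤ 1 := Real.rpow_le_one hx.le h (by linarith)
        nlinarith [mul_nonneg (sq_nonneg r) hrp.le]
      · nlinarith [mul_le_mul_of_nonneg_right
          (show (1 + r) ^ 2 ≤ 4 * r ^ 2 by nlinarith) hrp.le]
    calc (1 + ‖x‖) ^ 2 * r ^ (p - 2) ≤ (1 + K) ^ 2 * (1 + r) ^ 2 * r ^ (p - 2) :=
          mul_le_mul_of_nonneg_right hR hrp.le
      _ = (1 + K) ^ 2 * ((1 + r) ^ 2 * r ^ (p - 2)) := by ring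
      _ ≤ (1 + K) ^ 2 * (4 * (1 + r ^ 2 * r ^ (p - 2))) := by gcongr
      _ = _ := by ring

theorem frob_nonneg {n d : ℕ} (M : Matrix (Fin n) (Fin d) ℝ) : 0 ≤ frob M := Real.sqrt_nonneg _

theorem row_sq_le_frob_sq {n d : ℕ} (M : Matrix (Fin n) (Fin d) ℝ) (i : Fin n) :
    ∑ k, M i k ^ 2 ≤ frob M ^ 2 := by
  rw [frob, Real.sq_sqrt (by positivity)]
  exact Finset.single_le_sum (f := fun i => ∑ k, M i k ^ 2) (fun _ _ => by positivity)
    (Finset.mem_univ i)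

theorem abs_entry_le_frob {n d : ℕ} (M : Matrix (Fin n) (Fin d) ℝ) (i : Fin n) (k : Fin d) :
    |M i k| ≤ frob M :=
  abs_le_of_sq_le_sq ((Finset.single_le_sum (f := fun k => M i k ^ 2)
    (fun _ _ => sq_nonneg _) (Finset.mem_univ k)).trans (row_sq_le_frob_sq M i)) (frob_nonneg M)

theorem abs_mul_transpose_le {n d : ℕ} (M : Matrix (Fin n) (Fin d) ℝ) (i j : Fin n) :
    |(M * Mᵀ) i j| ≤ frob M ^ 2 := by
  rw [Matrix.mul_apply]
  calc |∑ k, M i k * Mᵀ k j| ≤ ∑ k, (M i k ^ 2 + M j k ^ 2) / 2 := by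
        refine (Finset.abs_sum_le_sum_abs _ _).trans (Finset.sum_le_sum fun k _ => ?_)
        rw [Matrix.transpose_apply, abs_le]
        constructor <;> nlinarith [sq_nonneg (M i k - M j k), sq_nonneg (M i k + M j k)]
    _ = (∑ k, M i k ^ 2 + ∑ k, M j k ^ 2) / 2 := by
        rw [← Finset.sum_div, Finset.sum_add_distrib]
    _ ≤ frob M ^ 2 := by linarith [row_sq_le_frob_sq M i, row_sq_le_frob_sq M j]

theorem norm_le_sum_abs {d : ℕ} (z : Ed d) : ‖z‖ ≤ ∑ k, |z k| := by
  rw [EuclideanSpace.norm_eq]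
  refine Real.sqrt_le_iff.2 ⟨by positivity, ?_⟩
  simp only [Real.norm_eq_abs]
  exact Finset.sum_sq_le_sq_sum_of_nonneg fun _ _ => abs_nonneg _

section Bounds

variable {n d : ℕ} {p K A : ℝ} {a : ℝ → En n → En n}
  {σm : ℝ → En n → Matrix (Fin n) (Fin d) ℝ} {t : ℝ} {x : En n}

theorem growth_mul_radial_pred_le (hp : 2 < p) (hK : 0 < K) :
    (1 + ‖x‖) * radial (p - 1) K x ≤ (1 + ‖x‖) ^ 2 * radial (p - 2) K x := by
  have hs := radial_succ_le (p := p - 2) (by linarith) hK x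
  rw [show p - 2 + 1 = p - 1 by ring] at hs
  have hr := radial_nonneg (p - 2) K x
  calc (1 + ‖x‖) * radial (p - 1) K x ≤ (1 + ‖x‖) * ((1 + ‖x‖) * radial (p - 2) K x) :=
        mul_le_mul_of_nonneg_left (by linarith) (by positivity)
    _ = _ := by ring

theorem genL_radial_le (hp : 2 < p) (hK : 0 < K) (hA : 0 < A)
    (hg : ‖a t x‖ + frob (σm t x) ≤ A * (1 + ‖x‖)) :
    genL a σm (fun _ => radial p K) t x ≤
      (n * (A * p) + 1 / 2 * (n * (n * (A ^ 2 * (p * (p + 1)))))) *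
        ((1 + ‖x‖) ^ 2 * radial (p - 2) K x) := by
  have hr1 := radial_nonneg (p - 1) K x
  have hr2 := radial_nonneg (p - 2) K x
  have hf := frob_nonneg (σm t x)
  have hq := growth_mul_radial_pred_le (x := x) hp hK
  have b1 : ∑ j, a t x j * pd (radial p K) x j ≤
      ∑ _j : Fin n, A * p * ((1 + ‖x‖) ^ 2 * radial (p - 2) K x) := by
    refine Finset.sum_le_sum fun j _ => (le_abs_self _).trans ?_
    rw [abs_mul]
    calc |a t x j| * |pd (radial p K) x j|
        ≤ (A * (1 + ‖x‖)) * (p * radial (p - 1) K x) :=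
          mul_le_mul ((abs_coord_le _ _).trans (by linarith))
            (abs_pd_radial_le (by linarith) hK x j) (abs_nonneg _) (by positivity)
      _ = A * p * ((1 + ‖x‖) * radial (p - 1) K x) := by ring
      _ ≤ _ := mul_le_mul_of_nonneg_left hq (by positivity)
  have b2 : ∑ i, ∑ j, (σm t x * (σm t x)ᵀ) i j * pd2 (radial p K) x i j ≤
      ∑ _i : Fin n, ∑ _j : Fin n,
        A ^ 2 * (p * (p + 1)) * ((1 + ‖x‖) ^ 2 * radial (p - 2) K x) := by
    refine Finset.sum_le_sum fun i _ => Finset.sum_le_sum fun j _ => (le_abs_self _).trans ?_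
    rw [abs_mul]
    calc |(σm t x * (σm t x)ᵀ) i j| * |pd2 (radial p K) x i j|
        ≤ (A * (1 + ‖x‖)) ^ 2 * (p * (p + 1) * radial (p - 2) K x) :=
          mul_le_mul ((abs_mul_transpose_le _ _ _).trans
              (pow_le_pow_left₀ hf (by linarith [norm_nonneg (a t x)]) 2))
            (abs_pd2_radial_le hp hK x i j) (abs_nonneg _) (by positivity)
      _ = _ := by ring
  simp only [Finset.sum_const, Finset.card_univ, Fintype.card_fin, nsmul_eq_mul] at b1 b2
  rw [genL]
  linarith

theorem norm_sigGrad_radial_le (hp : 2 < p) (hK : 0 < K) (hA : 0 < A)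
    (hg : ‖a t x‖ + frob (σm t x) ≤ A * (1 + ‖x‖)) :
    ‖sigGrad σm (fun _ => radial p K) t x‖ ≤
      d * (n * (A * p)) * ((1 + ‖x‖) ^ 2 * radial (p - 2) K x) := by
  have hr1 := radial_nonneg (p - 1) K x
  have hq := growth_mul_radial_pred_le (x := x) hp hK
  have b : ∑ k, |sigGrad σm (fun _ => radial p K) t x k| ≤
      ∑ _k : Fin d, ∑ _i : Fin n, A * p * ((1 + ‖x‖) ^ 2 * radial (p - 2) K x) := by
    refine Finset.sum_le_sum fun k _ => ?_
    change |∑ i, σm t x i k * pd (radial p K) x i| ≤ _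
    refine (Finset.abs_sum_le_sum_abs _ _).trans (Finset.sum_le_sum fun i _ => ?_)
    rw [abs_mul]
    calc |σm t x i k| * |pd (radial p K) x i|
        ≤ (A * (1 + ‖x‖)) * (p * radial (p - 1) K x) :=
          mul_le_mul ((abs_entry_le_frob (σm t x) i k).trans (by linarith [norm_nonneg (a t x)]))
            (abs_pd_radial_le (by linarith) hK x i) (abs_nonneg _) (by positivity)
      _ = A * p * ((1 + ‖x‖) * radial (p - 1) K x) := by ring
      _ ≤ _ := mul_le_mul_of_nonneg_left hq (by positivity)
  simp only [Finset.sum_const, Finset.card_univ, Fintype.card_fin, nsmul_eq_mul] at b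
  refine (norm_le_sum_abs _).trans (b.trans_eq ?_)
  ring

end Bounds

section Linearity

variable {n d : ℕ} {g h : En n → ℝ}

theorem pd_sub_const_mul (hg : Differentiable ℝ g) (hh : Differentiable ℝ h) (c : ℝ)
    (x : En n) (i : Fin n) :
    pd (fun y => g y - c * (1 + h y)) x i = pd g x i - c * pd h x i := by
  have H := (hg x).hasFDerivAt.sub (((hh x).hasFDerivAt.const_add 1).const_mul c)
  refine (congrArg (fun B : En n →L[ℝ] ℝ => B (EuclideanSpace.single i 1)) H.fderiv).trans ?_
  simp [pd]

theorem differentiable_pd (hg : ContDiff ℝ 2 g) (j : Fin n) :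
    Differentiable ℝ fun y => pd g y j :=
  (((hg.fderiv_right (m := 1) (by norm_num)).clm_apply contDiff_const).differentiable (by simp))

theorem pd2_sub_const_mul (hg : ContDiff ℝ 2 g) (hh : ContDiff ℝ 2 h) (c : ℝ)
    (x : En n) (i j : Fin n) :
    pd2 (fun y => g y - c * (1 + h y)) x i j = pd2 g x i j - c * pd2 h x i j := by
  have e : (fun y => pd (fun y => g y - c * (1 + h y)) y j) = fun y => pd g y j - c * pd h y j :=
    funext fun y => pd_sub_const_mul (hg.differentiable (by simp)) (hh.differentiable (by simp)) c y j
  have H := (differentiable_pd hg j x).hasFDerivAt.sub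
    ((differentiable_pd hh j x).hasFDerivAt.const_mul c)
  refine (congrArg (fun F : En n → ℝ => fderiv ℝ F x (EuclideanSpace.single i 1)) e).trans ?_
  refine (congrArg (fun B : En n →L[ℝ] ℝ => B (EuclideanSpace.single i 1)) H.fderiv).trans ?_
  simp [pd2, pd]

theorem genL_sub_const_mul (a : ℝ → En n → En n) (σm : ℝ → En n → Matrix (Fin n) (Fin d) ℝ)
    {φ : ℝ → En n → ℝ} {t : ℝ} (hφ : ContDiff ℝ 2 (φ t)) (hh : ContDiff ℝ 2 h) (c : ℝ → ℝ)
    (x : En n) :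
    genL a σm (fun s y => φ s y - c s * (1 + h y)) t x =
      genL a σm φ t x - c t * genL a σm (fun _ => h) t x := by
  simp only [genL, pd2_sub_const_mul hφ hh,
    pd_sub_const_mul (hφ.differentiable (by simp)) (hh.differentiable (by simp)),
    mul_sub ((_ : Matrix (Fin n) (Fin n) ℝ) _ _), mul_sub (a t x _), mul_left_comm _ (c t),
    Finset.sum_sub_distrib, ← Finset.mul_sum]
  ring

theorem sigGrad_sub_const_mul (σm : ℝ → En n → Matrix (Fin n) (Fin d) ℝ)
    {φ : ℝ → En n → ℝ} {t : ℝ} (hφ : Differentiable ℝ (φ t)) (hh : Differentiable ℝ h)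
    (c : ℝ → ℝ) (x : En n) :
    sigGrad σm (fun s y => φ s y - c s * (1 + h y)) t x - sigGrad σm φ t x =
      -(c t • sigGrad σm (fun _ => h) t x) := by
  ext k
  simp [sigGrad, pd_sub_const_mul hφ hh, mul_sub, Finset.sum_sub_distrib, Finset.mul_sum,
    mul_left_comm]

end Linearity

/-- If `v` is a viscosity supersolution of the QVI with
`|v(t,x)| ≤ C(1+|x|^{2ϱ})`, then there is `γ₀ > 0` such that for every `γ > γ₀` and `θ > 0`
the function `v + θ e^{-γt}(1 + ((|x|-K_Γ)⁺)^{2ϱ+2})` is again a viscosity supersolution. -/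
theorem supersolution_perturbation
    (n d : ℕ) (hn : 0 < n) (hd : 0 < d) (T : ℝ) (hT : 0 < T)
    (U : Type) [MetricSpace U] [CompactSpace U] [Nonempty U]
    (Γ : ℝ → En n → U → En n) (ℓ : ℝ → En n → U → ℝ)
    (a : ℝ → En n → En n) (σm : ℝ → En n → Matrix (Fin n) (Fin d) ℝ)
    (f : ℝ → En n → ℝ → Ed d → ℝ) (ψ : En n → ℝ)
    (KΓ kf Caσ : ℝ) (hKΓ : 0 < KΓ) (hkf : 0 < kf) (hCaσ : 0 < Caσ)
    -- assumptions on Γ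
    (hΓc : ContinuousOn (fun p : ℝ × En n × U => Γ p.1 p.2.1 p.2.2)
      (Icc 0 T ×ˢ (univ : Set (En n × U))))
    (hΓb : ∀ t ∈ Icc (0:ℝ) T, ∀ (x : En n) (b : U), ‖Γ t x b‖ ≤ max KΓ ‖x‖)
    -- assumptions on ℓ
    (hℓc : ContinuousOn (fun p : ℝ × En n × U => ℓ p.1 p.2.1 p.2.2)
      (Icc 0 T ×ˢ (univ : Set (En n × U))))
    (hℓnn : ∀ t ∈ Icc (0:ℝ) T, ∀ (x : En n) (b : U), 0 ≤ ℓ t x b)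
    -- ψ continuous
    (hψc : Continuous ψ)
    -- assumptions on a and σ
    (hac : ContinuousOn (fun p : ℝ × En n => a p.1 p.2) (Strip n T))
    (hσc : ContinuousOn (fun p : ℝ × En n => σm p.1 p.2) (Strip n T))
    (haσg : ∀ t ∈ Icc (0:ℝ) T, ∀ x : En n, ‖a t x‖ + frob (σm t x) ≤ Caσ * (1 + ‖x‖))
    -- f Lipschitz in (y,z) uniformly in (t,x), with constant kf
    (hfLip : ∀ t ∈ Icc (0:ℝ) T, ∀ (x : En n) (y y' : ℝ) (z z' : Ed d),
      |f t x y' z' - f t x y z| ≤ kf * (|y' - y| + ‖z' - z‖))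
    -- the supersolution v and its growth bound
    (v : ℝ → En n → ℝ) (C ϱ : ℝ) (hC : 0 < C) (hϱ : 0 < ϱ)
    (hvg : ∀ t ∈ Icc (0:ℝ) T, ∀ x : En n, |v t x| ≤ C * (1 + ‖x‖ ^ (2*ϱ)))
    (hv : IsSuper T Γ ℓ a σm f ψ v) :
    ∃ γ₀ > (0:ℝ), ∀ γ > γ₀, ∀ θ > (0:ℝ),
      IsSuper T Γ ℓ a σm f ψ
        (fun t x => v t x + θ * Real.exp (-γ * t) * (1 + (max (‖x‖ - KΓ) 0) ^ (2*ϱ + 2))) := by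
  set p : ℝ := 2 * ϱ + 2 with hpdef
  have hp : 2 < p := by linarith
  obtain ⟨hlsc, hterm, hvisc⟩ := hv
  set D : ℝ := (n * (Caσ * p) + 1 / 2 * (n * (n * (Caσ ^ 2 * (p * (p + 1)))))
    + kf * (d * (n * (Caσ * p)))) * (4 * (1 + KΓ) ^ 2) with hD
  have hp0 : 0 < p := by linarith
  have hDnn : 0 ≤ D := by positivity
  have hbound : ∀ t ∈ Icc (0 : ℝ) T, ∀ x : En n,
      genL a σm (fun _ => radial p KΓ) t x + kf * ‖sigGrad σm (fun _ => radial p KΓ) t x‖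
        ≤ D * (1 + radial p KΓ x) := by
    intro t ht x
    have h1 := genL_radial_le hp hKΓ hCaσ (haσg t ht x)
    have h2 := mul_le_mul_of_nonneg_left
      (norm_sigGrad_radial_le hp hKΓ hCaσ (haσg t ht x)) hkf.le
    have h3 := mul_le_mul_of_nonneg_left (sq_mul_radial_le hp hKΓ x)
      (show 0 ≤ n * (Caσ * p) + 1 / 2 * (n * (n * (Caσ ^ 2 * (p * (p + 1)))))
        + kf * (d * (n * (Caσ * p))) by positivity)
    rw [hD]
    linarith
  have hrad : ContDiff ℝ 2 (radial p KΓ : En n → ℝ) := contDiff_radial hp hKΓ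
  refine ⟨D + kf, by positivity, fun γ hγ θ hθ => ?_⟩
  set c : ℝ → ℝ := fun t => θ * Real.exp (-γ * t) with hc
  have hcpos : ∀ t, 0 < c t := fun t => mul_pos hθ (Real.exp_pos _)
  have hcd : ContDiff ℝ 2 c := by fun_prop
  change IsSuper T Γ ℓ a σm f ψ (fun t x => v t x + c t * (1 + radial p KΓ x))
  refine ⟨?_, fun x => ?_, fun t ht x φ hφ hφv hmax => ?_⟩
  · refine hlsc.add (Continuous.lowerSemicontinuous ?_ |>.lowerSemicontinuousOn _)
    exact (hcd.continuous.comp continuous_fst).mul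
      (continuous_const.add (hrad.continuous.comp continuous_snd))
  · have := mul_nonneg (hcpos T).le (add_nonneg zero_le_one (radial_nonneg p KΓ x))
    linarith [hterm x]
  have htI : t ∈ Icc (0 : ℝ) T := ⟨ht.1, ht.2.le⟩
  have hw : 0 ≤ c t * (1 + radial p KΓ x) :=
    mul_nonneg (hcpos t).le (add_nonneg zero_le_one (radial_nonneg p KΓ x))
  have htest : IsTest (fun s y => φ s y - c s * (1 + radial p KΓ y)) :=
    ContDiff.sub hφ ((hcd.comp contDiff_fst).mul (contDiff_const.add (hrad.comp contDiff_snd)))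
  have hφt : ContDiff ℝ 2 (φ t) := hφ.comp (contDiff_const.prodMk contDiff_id)
  have hφx : ContDiff ℝ 2 (fun s => φ s x) := hφ.comp (contDiff_id.prodMk contDiff_const)
  have hsuper := hvisc t ht x _ htest (by simp only [hφv]; ring) (by
    convert hmax using 2
    ring)
  obtain ⟨hM, hpde⟩ := le_min_iff.1 hsuper
  refine le_min (sub_nonneg.2 (ciSup_le fun b => ?_)) ?_
  · have hbdd : BddAbove (range fun b => v t (Γ t x b) - ℓ t x b) := by
      refine ⟨C * (1 + (max KΓ ‖x‖) ^ (2 * ϱ)), ?_⟩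
      rintro _ ⟨b, rfl⟩
      have h1 := (le_abs_self _).trans (hvg t htI (Γ t x b))
      have h2 : ‖Γ t x b‖ ^ (2 * ϱ) ≤ (max KΓ ‖x‖) ^ (2 * ϱ) :=
        Real.rpow_le_rpow (norm_nonneg _) (hΓb t htI x b) (by positivity)
      have h3 := mul_le_mul_of_nonneg_left h2 hC.le
      have h4 := hℓnn t htI x b
      dsimp only
      linarith
    have h1 : v t (Γ t x b) - ℓ t x b ≤ v t x :=
      (le_ciSup hbdd b).trans (sub_nonneg.1 hM)
    have h2 : radial p KΓ (Γ t x b) ≤ radial p KΓ x := by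
      refine Real.rpow_le_rpow (le_max_right _ _) (max_le ?_ (le_max_right _ _)) hp0.le
      rcases le_max_iff.1 (hΓb t htI x b) with h | h
      · exact le_max_of_le_right (by linarith)
      · exact le_max_of_le_left (by linarith)
    have h3 := mul_le_mul_of_nonneg_left h2 (hcpos t).le
    linarith
  · have hptd : ptd (fun s y => φ s y - c s * (1 + radial p KΓ y)) t x =
        ptd φ t x + γ * (c t * (1 + radial p KΓ x)) := by
      have h1 : HasDerivAt c (θ * (Real.exp (-γ * t) * (-γ * 1))) t :=
        (((hasDerivAt_id t).const_mul (-γ)).exp).const_mul θ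
      have h2 := (hφx.differentiable (by simp) t).hasDerivAt.sub
        (h1.mul_const (1 + radial p KΓ x))
      refine h2.deriv.trans ?_
      rw [ptd, hc]
      ring
    rw [hptd, genL_sub_const_mul a σm hφt hrad] at hpde
    have hlip := (abs_le.1 (hfLip t htI x (v t x + c t * (1 + radial p KΓ x)) (v t x)
      (sigGrad σm φ t x) (sigGrad σm (fun s y => φ s y - c s * (1 + radial p KΓ y)) t x))).1
    rw [sigGrad_sub_const_mul σm (hφt.differentiable (by simp)) (hrad.differentiable (by simp)),
      norm_neg, norm_smul, Real.norm_eq_abs, abs_of_pos (hcpos t), sub_add_cancel_left, abs_neg,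
      abs_of_nonneg hw] at hlip
    have hb := mul_le_mul_of_nonneg_left (hbound t htI x) (hcpos t).le
    have hγw := mul_nonneg (sub_nonneg.2 hγ.le) hw
    dsimp only
    linarith
end
end

section
/- For any locally bounded function u : [0,T] × ℝ^n → ℝ, the function M(u^*) is upper semicontinuous on [0,T] × ℝ^n, where u^* denotes the upper semicontinuous envelope of u. -/
open Set Filter Matrix Topology

noncomputable section

/-- Upper semicontinuous envelope of `u` on `[0,T] × ℝ^n`:
`u^*(t,x) = limsup_{(t',x') → (t,x)} u(t',x')`. -/
noncomputable def uscEnv {n : ℕ} (T : ℝ) (u : ℝ → En n → ℝ) (t : ℝ) (x : En n) : ℝ :=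
  Filter.limsup (fun q : ℝ × En n => u q.1 q.2) (𝓝[Strip n T] (t, x))

/-- The relative upper limit of a locally bounded function is upper semicontinuous. -/
theorem upperSemicontinuousOn_limsup_nhdsWithin {X : Type*} [TopologicalSpace X]
    {s : Set X} {f : X → ℝ} (hf : ∀ p ∈ s, ∃ C, ∀ᶠ q in 𝓝[s] p, |f q| ≤ C) :
    UpperSemicontinuousOn (fun p => limsup f (𝓝[s] p)) s := by
  intro p hp y hy
  obtain ⟨C, hC⟩ := hf p hp
  obtain ⟨c, hc, hcy⟩ := exists_between hy
  have hlt : ∀ᶠ q in 𝓝[s] p, f q < c :=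
    eventually_lt_of_limsup_lt hc
      (isBoundedUnder_of_eventually_le (hC.mono fun _ h => (abs_le.1 h).2))
  filter_upwards [eventually_eventually_nhdsWithin.2 hlt, self_mem_nhdsWithin] with q hq hqs
  obtain ⟨D, hD⟩ := hf q hqs
  have := mem_closure_iff_nhdsWithin_neBot.1 (subset_closure hqs)
  refine lt_of_le_of_lt (limsup_le_of_le ?_ (hq.mono fun _ h => h.le)) hcy
  exact (isBoundedUnder_of_eventually_ge
    (hD.mono fun _ h => (abs_le.1 h).1)).isCoboundedUnder_le

/-- The supremum over a compact parameter space of a jointly upper semicontinuous function is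
upper semicontinuous. -/
theorem UpperSemicontinuousOn.ciSup_of_compactSpace {X U : Type*} [TopologicalSpace X]
    [TopologicalSpace U] [CompactSpace U] [Nonempty U] {s : Set X} {g : X × U → ℝ}
    (hg : UpperSemicontinuousOn g (s ×ˢ univ)) :
    UpperSemicontinuousOn (fun p => ⨆ b, g (p, b)) s := by
  intro p hp y hy
  obtain ⟨c, hc, hcy⟩ := exists_between hy
  have hslice : UpperSemicontinuousOn (fun b => g (p, b)) univ :=
    hg.comp (by fun_prop) fun b _ => ⟨hp, mem_univ b⟩
  have hbdd : BddAbove (range fun b => g (p, b)) := by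
    simpa using hslice.bddAbove_of_isCompact isCompact_univ
  have hev : ∀ᶠ q in 𝓝[s] p ×ˢ 𝓝ˢ (univ : Set U), g q < c := by
    rw [isCompact_univ.prod_nhdsSet_eq_biSup]
    simp only [eventually_iSup]
    intro b _
    have := hg (p, b) ⟨hp, mem_univ b⟩ c ((le_ciSup hbdd b).trans_lt hc)
    rwa [nhdsWithin_prod_eq, nhdsWithin_univ] at this
  rw [nhdsSet_univ, ← principal_univ] at hev
  filter_upwards [eventually_prod_principal_iff.1 hev] with q hq
  exact (ciSup_le fun b => (hq b (mem_univ b)).le).trans_lt hcy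

/-- For a locally bounded `u`, the function `M(u^*)` is upper
semicontinuous on `[0,T] × ℝ^n`. -/
theorem Mop_uscEnv_upperSemicontinuous
    (n : ℕ) (hn : 0 < n) (T : ℝ) (hT : 0 < T)
    (U : Type) [MetricSpace U] [CompactSpace U] [Nonempty U]
    (Γ : ℝ → En n → U → En n) (ℓ : ℝ → En n → U → ℝ)
    (hΓc : ContinuousOn (fun p : ℝ × En n × U => Γ p.1 p.2.1 p.2.2)
      (Icc 0 T ×ˢ (univ : Set (En n × U))))
    (hℓc : ContinuousOn (fun p : ℝ × En n × U => ℓ p.1 p.2.1 p.2.2)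
      (Icc 0 T ×ˢ (univ : Set (En n × U))))
    (u : ℝ → En n → ℝ) (hu : LocBdd T u) :
    UpperSemicontinuousOn
      (fun p : ℝ × En n => Mop Γ ℓ (uscEnv T u) p.1 p.2) (Strip n T) := by
  have henv : UpperSemicontinuousOn (fun p : ℝ × En n => uscEnv T u p.1 p.2) (Strip n T) := by
    refine upperSemicontinuousOn_limsup_nhdsWithin fun p hp => ?_
    obtain ⟨s, hs, C, hC⟩ := hu p hp
    exact ⟨C, by
      filter_upwards [mem_nhdsWithin_of_mem_nhds hs, self_mem_nhdsWithin] with q hq hqs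
      exact hC q ⟨hq, hqs⟩⟩
  have hassoc : MapsTo (fun q : (ℝ × En n) × U => (q.1.1, q.1.2, q.2))
      (Strip n T ×ˢ univ) (Icc 0 T ×ˢ univ) := fun q hq => ⟨hq.1.1, mem_univ _⟩
  have hΓ : ContinuousOn (fun q : (ℝ × En n) × U => (q.1.1, Γ q.1.1 q.1.2 q.2))
      (Strip n T ×ˢ univ) :=
    ContinuousOn.prodMk (by fun_prop) (hΓc.comp (by fun_prop) hassoc)
  have hℓ : ContinuousOn (fun q : (ℝ × En n) × U => -ℓ q.1.1 q.1.2 q.2)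
      (Strip n T ×ˢ univ) := (hℓc.comp (by fun_prop) hassoc).neg
  have hsum := (henv.comp hΓ fun q hq => ⟨hq.1.1, mem_univ _⟩).add hℓ.upperSemicontinuousOn
  simpa only [Mop, sub_eq_add_neg, Function.comp_apply] using hsum.ciSup_of_compactSpace
end
end

section
/- Suppose |Γ(t,x,b)| ≤ K_Γ ∨ |x| for all (t,x,b) and that v : [0,T] × ℝ^n → ℝ satisfies the obstacle inequality v(t,x) ≥ Mv(t,x) for all (t,x) ∈ [0,T] × ℝ^n. Then for every θ ≥ 0, γ ∈ ℝ and ϱ > 0, the function w(t,x) := v(t,x) + θ e^{−γt}(1 + ((|x| − K_Γ)^+)^{2ϱ+2}) also satisfies w(t,x) ≥ Mw(t,x) for all (t,x) ∈ [0,T] × ℝ^n. -/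
open Set Filter Matrix Topology

noncomputable section

/-- If `|Γ(t,x,b)| ≤ K_Γ ∨ |x|` and `v ≥ Mv` on `[0,T] × ℝ^n`, then for
every `θ ≥ 0`, `γ ∈ ℝ` and `ϱ > 0` the function
`w(t,x) = v(t,x) + θ e^{-γt}(1 + ((|x|-K_Γ)⁺)^{2ϱ+2})` also satisfies `w ≥ Mw`. -/
theorem obstacle_inequality_preserved
    (n : ℕ) (hn : 0 < n) (T : ℝ) (hT : 0 < T)
    (U : Type) [MetricSpace U] [CompactSpace U] [Nonempty U]
    (Γ : ℝ → En n → U → En n) (ℓ : ℝ → En n → U → ℝ)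
    (KΓ : ℝ) (hKΓ : 0 < KΓ)
    (hΓb : ∀ t ∈ Icc (0:ℝ) T, ∀ (x : En n) (b : U), ‖Γ t x b‖ ≤ max KΓ ‖x‖)
    (v : ℝ → En n → ℝ)
    -- the suprema defining Mv are finite
    (hbdd : ∀ t ∈ Icc (0:ℝ) T, ∀ x : En n,
      BddAbove (range fun b : U => v t (Γ t x b) - ℓ t x b))
    (hobs : ∀ t ∈ Icc (0:ℝ) T, ∀ x : En n, Mop Γ ℓ v t x ≤ v t x)
    (θ γ ϱ : ℝ) (hθ : 0 ≤ θ) (hϱ : 0 < ϱ) :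
    ∀ t ∈ Icc (0:ℝ) T, ∀ x : En n,
      Mop Γ ℓ
        (fun s y => v s y + θ * Real.exp (-γ * s) * (1 + (max (‖y‖ - KΓ) 0) ^ (2*ϱ + 2)))
        t x
      ≤ v t x + θ * Real.exp (-γ * t) * (1 + (max (‖x‖ - KΓ) 0) ^ (2*ϱ + 2)) := by
  intro t ht x
  refine ciSup_le fun b => ?_
  have h_obs : v t (Γ t x b) - ℓ t x b ≤ v t x := (le_ciSup (hbdd t ht x) b).trans (hobs t ht x)
  have h_radius : max (‖Γ t x b‖ - KΓ) 0 ≤ max (‖x‖ - KΓ) 0 := by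
    have := hΓb t ht x b
    grind
  have h_penalty : θ * Real.exp (-γ * t) * (1 + (max (‖Γ t x b‖ - KΓ) 0) ^ (2*ϱ + 2))
      ≤ θ * Real.exp (-γ * t) * (1 + (max (‖x‖ - KΓ) 0) ^ (2*ϱ + 2)) := by
    gcongr
  linarith
end
end
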